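/- arXiv:2301.06623 — 2 statements merged into one kernel-verified Lean document; each statement's English description precedes it below -/
import Mathlib

section
/- Let ω_N ⊂ S^d (m, d ≥ 1) be an m-stiff configuration containing no antipodal pair of points, and let ω_N' := ω_N ∪ (-ω_N) be its symmetrization about the origin. Then ω_N' is also m-stiff and D_m(ω_N') = D_m(ω_N). -/
open MeasureTheory Metric
open scoped RealInnerProductSpace

noncomputable section

/-- `E n` is the Euclidean space `ℝ^n`; the unit sphere `S^{n-1}` is `Metric.sphere (0 : E n) 1`. -/
abbrev E (n : ℕ) : Type := EuclideanSpace ℝ (Fin n)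

/-- The surface area measure on the unit sphere of `ℝ^n`, normalized to be a probability
measure. -/
noncomputable def sphereUnif (n : ℕ) : Measure (sphere (0 : E n) 1) :=
  (((volume : Measure (E n)).toSphere) Set.univ)⁻¹ • (volume : Measure (E n)).toSphere

/-- `X` is a spherical `k`-design on the unit sphere of `ℝ^n`: all its points lie on the sphere
and every polynomial of total degree at most `k` has average over `X` equal to its average over
the sphere (with respect to the normalized surface area measure). -/
def IsSphericalDesign (n k : ℕ) (X : Finset (E n)) : Prop :=
  (↑X : Set (E n)) ⊆ sphere (0 : E n) 1 ∧
    ∀ p : MvPolynomial (Fin n) ℝ, p.totalDegree ≤ k →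
      (∑ x ∈ X, MvPolynomial.eval (fun i => x i) p) / (X.card : ℝ) =
        ∫ y, MvPolynomial.eval (fun i => (y : E n) i) p ∂(sphereUnif n)

/-- `Dm n m X` is the set of points `z` of the unit sphere of `ℝ^n` forming at most `m`
distinct dot products with the points of `X`. -/
def Dm (n m : ℕ) (X : Set (E n)) : Set (E n) :=
  {z | z ∈ sphere (0 : E n) 1 ∧ ∃ T : Finset ℝ, T.card ≤ m ∧ ∀ x ∈ X, ⟪z, x⟫ ∈ T}

/-- `X` is an `m`-stiff configuration on the unit sphere of `ℝ^n`: it is a spherical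
`(2m-1)`-design and some point of the sphere forms at most `m` distinct dot products with the
points of `X`. -/
def IsStiff (n m : ℕ) (X : Finset (E n)) : Prop :=
  IsSphericalDesign n (2 * m - 1) X ∧ (Dm n m ↑X).Nonempty

open MvPolynomial in
lemma negPoly_totalDegree {n : ℕ} (p : MvPolynomial (Fin n) ℝ) :
    (aeval (fun i => -(X i : MvPolynomial (Fin n) ℝ)) p).totalDegree ≤ p.totalDegree := by
  rw [aeval_def, eval₂_eq]
  refine totalDegree_finsetSum_le fun s hs => ?_
  refine (totalDegree_mul _ _).trans ?_
  have h1 : (algebraMap ℝ (MvPolynomial (Fin n) ℝ) (coeff s p)).totalDegree = 0 :=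
    totalDegree_C _
  rw [h1, zero_add]
  refine (totalDegree_finsetProd _ _).trans ?_
  refine le_trans ?_ (le_totalDegree hs)
  refine Finset.sum_le_sum fun i _ => ?_
  refine (totalDegree_pow _ _).trans ?_
  rw [totalDegree_neg, totalDegree_X, mul_one]

open MvPolynomial in
lemma negPoly_eval {n : ℕ} (p : MvPolynomial (Fin n) ℝ) (v : Fin n → ℝ) :
    eval v (aeval (fun i => -(X i : MvPolynomial (Fin n) ℝ)) p) = eval (fun i => - v i) p := by
  induction p using MvPolynomial.induction_on with
  | C a => simp
  | add p q hp hq => simp only [map_add, hp, hq]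
  | mul_X p i hp => simp only [map_mul, hp, aeval_X, map_neg, eval_X]

open scoped Pointwise in
lemma toSphere_map_neg (n : ℕ) :
    ((volume : Measure (E n)).toSphere).map (fun y => -y) = (volume : Measure (E n)).toSphere := by
  have hm : Measurable (fun y : sphere (0 : E n) 1 => -y) := continuous_neg.measurable
  ext s hs
  rw [Measure.map_apply hm hs, Measure.toSphere_apply' _ (hm hs), Measure.toSphere_apply' _ hs]
  congr 1
  rw [← Measure.measure_neg volume (Set.Ioo (0 : ℝ) 1 • (Subtype.val '' s))]
  congr 1
  ext x
  simp only [Set.mem_smul, Set.mem_neg, Set.mem_image, Set.mem_preimage]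
  constructor
  · rintro ⟨r, hr, _, ⟨y, hy, rfl⟩, rfl⟩
    exact ⟨r, hr, _, ⟨-y, hy, rfl⟩, by simp⟩
  · rintro ⟨r, hr, _, ⟨y, hy, rfl⟩, h⟩
    refine ⟨r, hr, _, ⟨-y, by simpa using hy, rfl⟩, ?_⟩
    rw [← neg_neg x, ← h]; simp

lemma sphereUnif_integral_neg (n : ℕ) (f : sphere (0 : E n) 1 → ℝ) :
    ∫ y, f (-y) ∂(sphereUnif n) = ∫ y, f y ∂(sphereUnif n) := by
  have h : (sphereUnif n).map (fun y => -y) = sphereUnif n := by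
    rw [sphereUnif, Measure.map_smul, toSphere_map_neg]
  conv_rhs => rw [← h]
  exact ((Homeomorph.neg (sphere (0 : E n) 1)).measurableEmbedding.integral_map f).symm

lemma design_neg {n k : ℕ} {X : Finset (E n)} (hX : IsSphericalDesign n k X)
    (p : MvPolynomial (Fin n) ℝ) (hp : p.totalDegree ≤ k) :
    (∑ x ∈ X, MvPolynomial.eval (fun i => (-x) i) p) / (X.card : ℝ) =
        ∫ y, MvPolynomial.eval (fun i => (y : E n) i) p ∂(sphereUnif n) := by
  have h := hX.2 _ ((negPoly_totalDegree p).trans hp)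
  simp only [negPoly_eval] at h
  rw [← sphereUnif_integral_neg]
  exact h

/-- The nodes of the quadrature are symmetric about the origin. -/
lemma dots_symm {n m : ℕ} (hm : 1 ≤ m) {X : Finset (E n)}
    (hX : IsSphericalDesign n (2 * m - 1) X) (z : E n) (A : Finset ℝ)
    (hA : A = X.image (fun x => ⟪z, x⟫)) (hc : A.card ≤ m) (a : ℝ) (ha : a ∈ A) : -a ∈ A := by
  by_contra hna
  have hAX : ∀ x ∈ X, ⟪z, x⟫ ∈ A := fun x hx => hA ▸ Finset.mem_image_of_mem _ hx
  let L : MvPolynomial (Fin n) ℝ := ∑ i, MvPolynomial.C (z i) * MvPolynomial.X i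
  have hLd : L.totalDegree ≤ 1 := by
    refine MvPolynomial.totalDegree_finsetSum_le fun i _ => ?_
    refine (MvPolynomial.totalDegree_mul _ _).trans ?_
    simp
  have hLe : ∀ x : E n, MvPolynomial.eval (fun i => x i) L = ⟪z, x⟫ := by
    intro x
    simp [L, PiLp.inner_apply, mul_comm]
  let p : MvPolynomial (Fin n) ℝ :=
    (∏ b ∈ A, (L - MvPolynomial.C b)) * ∏ c ∈ A.erase a, (L - MvPolynomial.C (-c))
  have hfac : ∀ (B : Finset ℝ) (f : ℝ → ℝ),
      (∏ b ∈ B, (L - MvPolynomial.C (f b))).totalDegree ≤ B.card := by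
    intro B f
    refine (MvPolynomial.totalDegree_finsetProd _ _).trans ?_
    rw [Finset.card_eq_sum_ones]
    exact Finset.sum_le_sum fun b _ => (MvPolynomial.totalDegree_sub_C_le _ _).trans hLd
  have hpd : p.totalDegree ≤ 2 * m - 1 := by
    refine (MvPolynomial.totalDegree_mul _ _).trans ?_
    have h1 := hfac A id
    have h2 := hfac (A.erase a) (fun c => -c)
    rw [Finset.card_erase_of_mem ha] at h2
    have := Finset.card_pos.2 ⟨a, ha⟩
    simp only [id] at h1 h2
    omega
  have hpe : ∀ x : E n, MvPolynomial.eval (fun i => x i) p =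
      (∏ b ∈ A, (⟪z, x⟫ - b)) * ∏ c ∈ A.erase a, (⟪z, x⟫ + c) := by
    intro x
    simp [p, MvPolynomial.eval_prod, hLe]
  have e1 := hX.2 p hpd
  rw [← design_neg hX p hpd] at e1
  have h0 : ∑ x ∈ X, MvPolynomial.eval (fun i => x i) p = 0 := by
    refine Finset.sum_eq_zero fun x hx => ?_
    rw [hpe, Finset.prod_eq_zero (hAX x hx) (sub_self _), zero_mul]
  obtain ⟨x0, hx0, hx0a⟩ := Finset.mem_image.1 (hA ▸ ha)
  have hcard : (X.card : ℝ) ≠ 0 := by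
    exact_mod_cast (Finset.card_pos.2 ⟨x0, hx0⟩).ne'
  set V : ℝ := (∏ b ∈ A, (-a - b)) * ∏ c ∈ A.erase a, (-a + c) with hV
  have hV0 : V ≠ 0 := by
    refine mul_ne_zero (Finset.prod_ne_zero_iff.2 fun b hb h => hna ?_)
      (Finset.prod_ne_zero_iff.2 fun c hc h => ?_)
    · rwa [sub_eq_zero.1 h]
    · exact (Finset.mem_erase.1 hc).1 (by linarith)
  have h1 : ∑ x ∈ X, MvPolynomial.eval (fun i => (-x) i) p =
      ∑ x ∈ X, if ⟪z, x⟫ = a then V else 0 := by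
    refine Finset.sum_congr rfl fun x hx => ?_
    rw [hpe, inner_neg_right]
    split_ifs with h
    · rw [h]
    · rw [Finset.prod_eq_zero (Finset.mem_erase.2 ⟨h, hAX x hx⟩) (neg_add_cancel _), mul_zero]
  rw [h0, zero_div, h1, ← Finset.sum_filter, Finset.sum_const, nsmul_eq_mul] at e1
  have h2 : ((X.filter (fun x => ⟪z, x⟫ = a)).card : ℝ) ≠ 0 := by
    exact_mod_cast (Finset.card_pos.2 ⟨x0, Finset.mem_filter.2 ⟨hx0, hx0a⟩⟩).ne'
  exact div_ne_zero (mul_ne_zero h2 hV0) hcard e1.symm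

/-- Lemma 5.1: if `ω_N ⊂ S^d` is `m`-stiff and contains no antipodal pair, then its
symmetrization `ω_N ∪ (-ω_N)` is also `m`-stiff, with the same dual configuration. -/
theorem symmetrization_isStiff (d m : ℕ) (hd : 1 ≤ d) (hm : 1 ≤ m)
    [DecidableEq (E (d + 1))] (X : Finset (E (d + 1)))
    (hstiff : IsStiff (d + 1) m X) (hantip : ∀ x ∈ X, -x ∉ X) :
    IsStiff (d + 1) m (X ∪ X.image (fun x => -x)) ∧
      Dm (d + 1) m ↑(X ∪ X.image (fun x => -x)) = Dm (d + 1) m ↑X := by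
  obtain ⟨hX, hne⟩ := hstiff
  have hD : Dm (d + 1) m ↑(X ∪ X.image (fun x => -x)) = Dm (d + 1) m ↑X := by
    ext z
    constructor
    · rintro ⟨hz, T, hT, h⟩
      exact ⟨hz, T, hT, fun x hx => h x (by
        rw [Finset.mem_coe] at hx ⊢
        exact Finset.mem_union_left _ hx)⟩
    · rintro ⟨hz, T, hT, h⟩
      have hc : (X.image (fun x => ⟪z, x⟫)).card ≤ m := by
        refine (Finset.card_le_card fun t ht => ?_).trans hT
        obtain ⟨x, hx, rfl⟩ := Finset.mem_image.1 ht
        exact h x hx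
      refine ⟨hz, X.image (fun x => ⟪z, x⟫), hc, fun x hx => ?_⟩
      rw [Finset.mem_coe, Finset.mem_union] at hx
      rcases hx with hx | hx
      · exact Finset.mem_image_of_mem _ hx
      · obtain ⟨y, hy, rfl⟩ := Finset.mem_image.1 hx
        rw [inner_neg_right]
        exact dots_symm hm hX z _ rfl hc _ (Finset.mem_image_of_mem _ hy)
  refine ⟨⟨⟨?_, ?_⟩, hD ▸ hne⟩, hD⟩
  · intro x hx
    rw [Finset.mem_coe, Finset.mem_union] at hx
    rcases hx with hx | hx
    · exact hX.1 hx
    · obtain ⟨y, hy, rfl⟩ := Finset.mem_image.1 hx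
      have := hX.1 hy
      simpa using this
  · intro p hp
    have hdis : Disjoint X (X.image (fun x => -x)) := by
      rw [Finset.disjoint_left]
      intro x hx hx2
      obtain ⟨y, hy, rfl⟩ := Finset.mem_image.1 hx2
      exact hantip y hy hx
    rw [Finset.sum_union hdis, Finset.card_union_of_disjoint hdis,
      Finset.card_image_of_injective _ neg_injective, Finset.sum_image (by simp)]
    have e1 := hX.2 p hp
    have e2 := design_neg hX p hp
    push_cast
    rw [← two_mul, add_div, mul_comm, ← div_div, ← div_div, e1, e2]
    ring
end
end

section
/- Let ω_N ⊂ S^d, d ≥ 1, be an m-stiff configuration with m ≥ 2. Then the dual D_m(ω_N) contains at most m^{d+1} points. Moreover, if D_m(ω_N) is not in general position (i.e., it is contained in some hyperplane of ℝ^{d+1}), then D_m(ω_N) is a 1-stiff configuration and is not a spherical 2-design; in particular, it is not m-stiff. -/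
open MeasureTheory Metric
open scoped RealInnerProductSpace

noncomputable section

open Polynomial in
theorem evalInnerPoly {n k : ℕ} (z : E n) (f : ℝ[X]) (hf : f.natDegree ≤ k) :
    ∃ p : MvPolynomial (Fin n) ℝ, p.totalDegree ≤ k ∧
      ∀ x : E n, MvPolynomial.eval (fun i => x i) p = f.eval ⟪z, x⟫ := by
  set l : MvPolynomial (Fin n) ℝ := ∑ i, MvPolynomial.C (z i) * MvPolynomial.X i with hl
  have hl1 : l.totalDegree ≤ 1 := by
    refine (MvPolynomial.totalDegree_finsetSum _ _).trans (Finset.sup_le fun i _ => ?_)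
    refine (MvPolynomial.totalDegree_mul _ _).trans ?_
    simp
  refine ⟨aeval l f, ?_, fun x => ?_⟩
  · rw [aeval_eq_sum_range]
    refine (MvPolynomial.totalDegree_finsetSum _ _).trans (Finset.sup_le fun i hi => ?_)
    refine (MvPolynomial.totalDegree_smul_le _ _).trans
      ((MvPolynomial.totalDegree_pow _ _).trans ?_)
    have : i ≤ f.natDegree := by simpa [Nat.lt_succ_iff] using hi
    nlinarith
  · have h1 : MvPolynomial.eval (fun i => x i) l = ⟪z, x⟫ := by
      simp [hl, PiLp.inner_apply, mul_comm]
    rw [← h1, aeval_def, hom_eval₂]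
    have : (MvPolynomial.eval (fun i => x i)).comp (algebraMap ℝ (MvPolynomial (Fin n) ℝ))
        = RingHom.id ℝ := by
      ext r; simp [MvPolynomial.algebraMap_eq]
    rw [this]; rfl

open Polynomial in
theorem design_inner {n k : ℕ} {X : Finset (E n)} (h : IsSphericalDesign n k X) (z : E n)
    (f : ℝ[X]) (hf : f.natDegree ≤ k) :
    (∑ x ∈ X, f.eval ⟪z, x⟫) / (X.card : ℝ) =
      ∫ y : sphere (0 : E n) 1, f.eval ⟪z, (y : E n)⟫ ∂(sphereUnif n) := by
  obtain ⟨p, hp, hpe⟩ := evalInnerPoly z f hf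
  have := h.2 p hp
  simpa only [hpe] using this

instance sphereUnif_prob (d : ℕ) : IsProbabilityMeasure (sphereUnif (d + 1)) := by
  constructor
  have h0 : (volume : Measure (E (d + 1))).toSphere Set.univ ≠ 0 := by
    rw [Ne, Measure.measure_univ_eq_zero]
    exact Measure.toSphere_ne_zero _
  rw [sphereUnif, Measure.smul_apply, smul_eq_mul]
  exact ENNReal.inv_mul_cancel h0 (measure_ne_top _ _)

instance sphereUnif_openPos (d : ℕ) : (sphereUnif (d + 1)).IsOpenPosMeasure := by
  constructor
  intro U hU hne
  rw [sphereUnif, Measure.smul_apply, smul_eq_mul]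
  exact mul_ne_zero (ENNReal.inv_ne_zero.2 (measure_ne_top _ _)) (hU.measure_ne_zero _ hne)

/-- A nonnegative continuous function with zero integral vanishes. -/
theorem sphere_pos (d : ℕ) (g : sphere (0 : E (d + 1)) 1 → ℝ) (hg : Continuous g)
    (h0 : ∀ y, 0 ≤ g y) (hi : ∫ y, g y ∂(sphereUnif (d + 1)) = 0) (y) : g y = 0 := by
  by_contra hne
  have := hg.integral_pos_of_hasCompactSupport_nonneg_nonzero (μ := sphereUnif (d + 1))
    (HasCompactSupport.of_compactSpace g) h0 hne
  exact this.ne' hi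

/-- The action of a linear isometry on the sphere. -/
def sphMap {n : ℕ} (e : E n ≃ₗᵢ[ℝ] E n) (y : sphere (0 : E n) 1) : sphere (0 : E n) 1 :=
  ⟨e y, by simp⟩

theorem sphMap_cont {n : ℕ} (e : E n ≃ₗᵢ[ℝ] E n) : Continuous (sphMap e) :=
  (e.continuous.comp continuous_subtype_val).subtype_mk _

open scoped Pointwise in
theorem toSphere_map {n : ℕ} (e : E n ≃ₗᵢ[ℝ] E n) :
    ((volume : Measure (E n)).toSphere).map (sphMap e) = (volume : Measure (E n)).toSphere := by
  ext s hs
  have hm := (sphMap_cont e).measurable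
  rw [Measure.map_apply hm hs, Measure.toSphere_apply' _ (hm hs), Measure.toSphere_apply' _ hs]
  congr 1
  have : Set.Ioo (0 : ℝ) 1 • (Subtype.val '' (sphMap e ⁻¹' s)) =
      e ⁻¹' (Set.Ioo (0 : ℝ) 1 • (Subtype.val '' s)) := by
    ext x
    simp only [Set.mem_smul, Set.mem_preimage, Set.mem_image]
    constructor
    · rintro ⟨r, hr, _, ⟨y, hy, rfl⟩, rfl⟩
      exact ⟨r, hr, _, ⟨_, hy, rfl⟩, by simp [sphMap]⟩
    · rintro ⟨r, hr, _, ⟨y, hy, rfl⟩, h⟩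
      refine ⟨r, hr, _, ⟨sphMap e.symm y, ?_, rfl⟩, ?_⟩
      · have : sphMap e (sphMap e.symm y) = y := by ext1; simp [sphMap]
        rwa [this]
      · apply e.injective
        rw [← h]; simp [sphMap]
  rw [this]
  exact e.measurePreserving.measure_preimage_emb e.toHomeomorph.measurableEmbedding _

theorem sphereUnif_rot {n : ℕ} (e : E n ≃ₗᵢ[ℝ] E n) (g : sphere (0 : E n) 1 → ℝ)
    (hg : Continuous g) :
    ∫ y, g (sphMap e y) ∂(sphereUnif n) = ∫ y, g y ∂(sphereUnif n) := by
  have h : (sphereUnif n).map (sphMap e) = sphereUnif n := by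
    rw [sphereUnif, Measure.map_smul, toSphere_map]
  conv_rhs => rw [← h]
  rw [integral_map (sphMap_cont e).aemeasurable hg.aestronglyMeasurable]

open Polynomial in
theorem inner_indep {n : ℕ} (z w : E n) (h : ‖z‖ = ‖w‖) (f : ℝ[X]) :
    ∫ y : sphere (0 : E n) 1, f.eval ⟪z, (y : E n)⟫ ∂(sphereUnif n) =
      ∫ y : sphere (0 : E n) 1, f.eval ⟪w, (y : E n)⟫ ∂(sphereUnif n) := by
  let e := Submodule.reflection (ℝ ∙ (z - w))ᗮ
  have he : e z = w := Submodule.reflection_sub h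
  rw [← sphereUnif_rot e (fun y => f.eval ⟪w, (y : E n)⟫) (by fun_prop)]
  congr 1
  ext y
  change _ = f.eval ⟪w, e (y : E n)⟫
  rw [← he, e.inner_map_map]

open Polynomial in
/-- If `f(z·y)` has zero second moment then `f = 0`. -/
theorem inner_sq_zero {d : ℕ} (hd : 1 ≤ d) (z : E (d + 1)) (hz : ‖z‖ = 1) (f : ℝ[X])
    (h : ∫ y : sphere (0 : E (d + 1)) 1, (f * f).eval ⟪z, (y : E (d + 1))⟫
      ∂(sphereUnif (d + 1)) = 0) : f = 0 := by
  have h0 := sphere_pos d _ (by fun_prop) (fun y => by rw [eval_mul]; exact mul_self_nonneg _) h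
  have hr : 1 < Module.rank ℝ (E (d + 1)) := by
    rw [← Module.finrank_eq_rank]
    simp only [finrank_euclideanSpace, Fintype.card_fin]
    exact_mod_cast (by omega : 1 < d + 1)
  have hc := isPreconnected_sphere hr (0 : E (d + 1)) 1
  have hiv := hc.intermediate_value (a := -z) (b := z) (by simp [hz]) (by simp [hz])
    (f := fun y => ⟪z, y⟫) (by fun_prop)
  refine eq_zero_of_infinite_isRoot f ((Set.Icc_infinite (show (-1 : ℝ) < 1 by norm_num)).mono ?_)
  intro t ht
  obtain ⟨y, hy, hyt⟩ := hiv (by simpa [hz] using ht)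
  have := h0 ⟨y, hy⟩
  simp only [eval_mul, mul_self_eq_zero] at this
  change f.eval t = 0
  rw [← hyt]; exact this

open Polynomial in
/-- Orthogonality of the nodal polynomial to all lower degree polynomials. -/
theorem nodal_orth {d m : ℕ} (hm : 1 ≤ m) {X : Finset (E (d + 1))}
    (h : IsSphericalDesign (d + 1) (2 * m - 1) X) (z : E (d + 1)) (T : Finset ℝ)
    (hT : T.card = m) (hzT : ∀ x ∈ X, ⟪z, x⟫ ∈ T) (r : ℝ[X]) (hr : r.degree < m) :
    ∫ y : sphere (0 : E (d + 1)) 1, ((∏ t ∈ T, (Polynomial.X - C t)) * r).eval ⟪z, (y : E (d + 1))⟫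
      ∂(sphereUnif (d + 1)) = 0 := by
  rw [← design_inner h]
  · rw [Finset.sum_eq_zero, zero_div]
    intro x hx
    rw [eval_mul, eval_prod, Finset.prod_eq_zero (hzT x hx) (by simp), zero_mul]
  · refine natDegree_mul_le.trans ?_
    rw [natDegree_finsetProd_X_sub_C_eq_card]
    have : r.natDegree < m := by
      by_cases h0 : r = 0
      · simp [h0]; omega
      · exact (natDegree_lt_iff_degree_lt h0).2 hr
    omega

open Polynomial in
theorem nodes_unique {d m : ℕ} (hd : 1 ≤ d) (hm : 1 ≤ m) {X : Finset (E (d + 1))}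
    (h : IsSphericalDesign (d + 1) (2 * m - 1) X) (z w : E (d + 1)) (hz : ‖z‖ = 1) (hw : ‖w‖ = 1)
    (T S : Finset ℝ) (hT : T.card = m) (hzT : ∀ x ∈ X, ⟪z, x⟫ ∈ T)
    (hS : S.card = m) (hwS : ∀ x ∈ X, ⟪w, x⟫ ∈ S) : T = S := by
  set p : ℝ[X] := ∏ t ∈ T, (Polynomial.X - C t) with hp
  set q : ℝ[X] := ∏ t ∈ S, (Polynomial.X - C t) with hq
  have hpm : p.Monic := monic_prod_of_monic _ _ fun t _ => monic_X_sub_C t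
  have hqm : q.Monic := monic_prod_of_monic _ _ fun t _ => monic_X_sub_C t
  have hpd : p.degree = m := by
    rw [degree_eq_natDegree hpm.ne_zero, hp, natDegree_finsetProd_X_sub_C_eq_card, hT]
  have hqd : q.degree = m := by
    rw [degree_eq_natDegree hqm.ne_zero, hq, natDegree_finsetProd_X_sub_C_eq_card, hS]
  have hlt : (p - q).degree < m := by
    rw [← hpd]
    exact degree_sub_lt (by rw [hpd, hqd]) hpm.ne_zero (by rw [hpm.leadingCoeff, hqm.leadingCoeff])
  have h1 := nodal_orth hm h z T hT hzT _ hlt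
  have h2 := nodal_orth hm h w S hS hwS _ hlt
  rw [inner_indep w z (by rw [hz, hw])] at h2
  have hi : ∀ f : ℝ[X], Integrable (fun y : sphere (0 : E (d + 1)) 1 =>
      f.eval ⟪z, (y : E (d + 1))⟫) (sphereUnif (d + 1)) := fun f =>
    Continuous.integrable_of_hasCompactSupport (by fun_prop) (HasCompactSupport.of_compactSpace _)
  have h3 : p - q = 0 := by
    apply inner_sq_zero hd z hz
    have : (p - q) * (p - q) = p * (p - q) - q * (p - q) := by ring
    rw [this]
    simp only [eval_sub (p * (p - q))]
    rw [integral_sub (hi _) (hi _), h1, h2, sub_zero]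
  have h4 : p.roots = q.roots := by rw [sub_eq_zero.1 h3]
  rw [hp, hq, roots_prod_X_sub_C, roots_prod_X_sub_C] at h4
  exact Finset.val_inj.1 h4

open Polynomial in
/-- Points of a 2-design are not orthogonal to a common nonzero vector. -/
theorem design_two {d k : ℕ} (hk : 2 ≤ k) {X : Finset (E (d + 1))}
    (h : IsSphericalDesign (d + 1) k X) (v : E (d + 1)) (hv : ∀ x ∈ X, ⟪v, x⟫ = 0) : v = 0 := by
  have h1 := design_inner h v (Polynomial.X ^ 2) (by simpa using hk)
  rw [Finset.sum_eq_zero (fun x hx => by simp [hv x hx]), zero_div] at h1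
  have h0 := sphere_pos d _ (by fun_prop) (fun y => by simp only [eval_pow]; positivity) h1.symm
  by_contra hne
  have := h0 ⟨(‖v‖)⁻¹ • v, by simp [norm_smul, hne]⟩
  simp [real_inner_smul_right, hne] at this

theorem design_mono {n k l : ℕ} (h : k ≤ l) {X : Finset (E n)} (hX : IsSphericalDesign n l X) :
    IsSphericalDesign n k X := ⟨hX.1, fun p hp => hX.2 p (hp.trans h)⟩

theorem poly_one {n : ℕ} (p : MvPolynomial (Fin n) ℝ) (hp : p.totalDegree ≤ 1) (x : Fin n → ℝ) :
    MvPolynomial.eval (fun i => -x i) p = 2 * p.coeff 0 - MvPolynomial.eval x p := by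
  have key : ∀ s ∈ p.support, p.coeff s * ∏ i, (-x i) ^ s i =
      (if s = 0 then 2 * p.coeff s else 0) - p.coeff s * ∏ i, x i ^ s i := by
    intro s hs
    have hs1 : s.sum (fun _ e => e) ≤ 1 := (MvPolynomial.le_totalDegree hs).trans hp
    rw [Finsupp.sum_fintype _ _ (fun _ => rfl)] at hs1
    have : ∏ i, (-x i) ^ s i = (-1) ^ (∑ i, s i) * ∏ i, x i ^ s i := by
      rw [← Finset.prod_pow_eq_pow_sum, ← Finset.prod_mul_distrib]
      refine Finset.prod_congr rfl fun i _ => ?_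
      rw [← mul_pow]; ring
    rw [this]
    split_ifs with h0
    · subst h0; simp; ring
    · have : ∑ i, s i = 1 := by
        have : ∑ i, s i ≠ 0 := fun h => h0 (by
          ext i; simpa using (Finset.sum_eq_zero_iff.1 h) i (Finset.mem_univ i))
        omega
      rw [this]; ring
  rw [MvPolynomial.eval_eq', MvPolynomial.eval_eq', Finset.sum_congr rfl key,
    Finset.sum_sub_distrib, Finset.sum_ite_eq']
  congr 1
  split_ifs with h
  · rfl
  · simp [MvPolynomial.notMem_support_iff.1 h]

theorem sym_design {d : ℕ} {Y : Finset (E (d + 1))} (hY : (Y : Set (E (d + 1))) ⊆ sphere 0 1)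
    (hne : Y.Nonempty) (hs : ∀ y ∈ Y, -y ∈ Y) : IsSphericalDesign (d + 1) 1 Y := by
  refine ⟨hY, fun p hp => ?_⟩
  have hcont : Continuous (fun y : sphere (0 : E (d + 1)) 1 =>
      MvPolynomial.eval (fun i => (y : E (d + 1)) i) p) := by
    have := MvPolynomial.continuous_eval p
    exact this.comp (by fun_prop)
  have hR : ∫ y : sphere (0 : E (d + 1)) 1, MvPolynomial.eval (fun i => (y : E (d + 1)) i) p
      ∂(sphereUnif (d + 1)) = p.coeff 0 := by
    have h1 := sphereUnif_rot (LinearIsometryEquiv.neg ℝ) _ hcont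
    have h2 : ∀ y : sphere (0 : E (d + 1)) 1,
        MvPolynomial.eval (fun i => (sphMap (LinearIsometryEquiv.neg ℝ) y : E (d + 1)) i) p =
        2 * p.coeff 0 - MvPolynomial.eval (fun i => (y : E (d + 1)) i) p := fun y =>
      poly_one p hp _
    simp only [h2] at h1
    rw [integral_sub (integrable_const _) (hcont.integrable_of_hasCompactSupport
      (HasCompactSupport.of_compactSpace _))] at h1
    simp only [integral_const, probReal_univ, one_smul] at h1
    linarith
  rw [hR]
  have hL : ∑ x ∈ Y, MvPolynomial.eval (fun i => x i) p =
      ∑ x ∈ Y, (2 * p.coeff 0 - MvPolynomial.eval (fun i => x i) p) := by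
    refine Finset.sum_bij' (fun x _ => -x) (fun x _ => -x) hs hs (by simp) (by simp) ?_
    intro x _
    have := poly_one p hp (fun i => x i)
    simp only [PiLp.neg_apply]
    rw [this]; ring
  rw [Finset.sum_sub_distrib, Finset.sum_const, nsmul_eq_mul] at hL
  have : (Y.card : ℝ) ≠ 0 := by exact_mod_cast hne.card_pos.ne'
  rw [div_eq_iff this]
  linarith

theorem Dm_neg {n m : ℕ} {X : Set (E n)} {z : E n} (hz : z ∈ Dm n m X) : -z ∈ Dm n m X := by
  obtain ⟨h1, T, hT, h⟩ := hz
  refine ⟨by simpa using h1, T.image (fun t => -t), Finset.card_image_le.trans hT, fun x hx => ?_⟩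
  rw [inner_neg_left]
  exact Finset.mem_image_of_mem _ (h x hx)

theorem Dm_nodes {d m : ℕ} (hd : 1 ≤ d) (hm : 2 ≤ m) {X : Finset (E (d + 1))}
    (hstiff : IsStiff (d + 1) m X) :
    ∃ T : Finset ℝ, T.card = m ∧ ∀ z ∈ Dm (d + 1) m ↑X, ∀ x ∈ X, ⟪z, x⟫ ∈ T := by
  obtain ⟨hdes, z₀, hz₀, T₀, hT₀, h₀⟩ := hstiff
  obtain ⟨T, hTT, hT⟩ := Infinite.exists_superset_card_eq T₀ m hT₀
  refine ⟨T, hT, ?_⟩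
  rintro z ⟨hz, S₀, hS₀, h⟩ x hx
  obtain ⟨S, hSS, hS⟩ := Infinite.exists_superset_card_eq S₀ m hS₀
  have := nodes_unique hd (by omega) hdes z₀ z (by simpa using hz₀) (by simpa using hz) T S hT
    (fun x hx => hTT (h₀ x hx)) hS (fun x hx => hSS (h x hx))
  rw [this]
  exact hSS (h x hx)

theorem Dm_bound {d m : ℕ} (hd : 1 ≤ d) (hm : 2 ≤ m) {X : Finset (E (d + 1))}
    (hstiff : IsStiff (d + 1) m X) :
    (Dm (d + 1) m ↑X).Finite ∧ (Dm (d + 1) m ↑X).ncard ≤ m ^ (d + 1) := by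
  classical
  obtain ⟨T, hT, h⟩ := Dm_nodes hd hm hstiff
  obtain ⟨b, hbX, hspan, hli⟩ := exists_linearIndependent ℝ (X : Set (E (d + 1)))
  have hbf : b.Finite := X.finite_toSet.subset hbX
  haveI := hbf.fintype
  have hcard : Fintype.card b ≤ d + 1 := by
    simpa using hli.fintype_card_le_finrank
  let F : E (d + 1) → (b → ℝ) := fun z x => ⟪z, (x : E (d + 1))⟫
  let P : Finset (b → ℝ) := Fintype.piFinset (fun _ => T)
  have hmaps : ∀ z ∈ Dm (d + 1) m ↑X, F z ∈ (P : Set (b → ℝ)) := by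
    intro z hz
    simp only [P, Finset.mem_coe, Fintype.mem_piFinset]
    exact fun x => h z hz x (hbX x.2)
  have hinj : Set.InjOn F (Dm (d + 1) m ↑X) := by
    intro z _ w _ hzw
    have hb0 : ∀ x ∈ Submodule.span ℝ b, ⟪z - w, x⟫ = 0 := by
      intro x hx
      induction hx using Submodule.span_induction with
      | mem x hx =>
        have := congrFun hzw ⟨x, hx⟩
        rw [inner_sub_left, sub_eq_zero]; exact this
      | zero => simp
      | add x y _ _ hx hy => rw [inner_add_right, hx, hy, add_zero]
      | smul a x _ hx => rw [inner_smul_right, hx, mul_zero]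
    refine sub_eq_zero.1 (design_two (by omega) hstiff.1 (z - w) fun x hx => hb0 x ?_)
    rw [hspan]; exact Submodule.subset_span hx
  refine ⟨Set.Finite.of_injOn hmaps hinj P.finite_toSet, ?_⟩
  refine (Set.ncard_le_ncard_of_injOn F hmaps hinj P.finite_toSet).trans ?_
  rw [Set.ncard_coe_finset, show P.card = T.card ^ Fintype.card b by simp [P], hT]
  exact Nat.pow_le_pow_right (by omega) hcard

/-- Proposition 6.6: for an `m`-stiff configuration `ω_N ⊂ S^d` with `m ≥ 2`, the dual
`D_m(ω_N)` has at most `m^{d+1}` points; moreover, if `D_m(ω_N)` is contained in some affine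
hyperplane of `ℝ^{d+1}`, then `D_m(ω_N)` is `1`-stiff, is not a spherical `2`-design, and in
particular is not `m`-stiff. -/
theorem dual_card_bound_and_general_position (d m : ℕ) (hd : 1 ≤ d) (hm : 2 ≤ m)
    (X : Finset (E (d + 1))) (hstiff : IsStiff (d + 1) m X) :
    (Dm (d + 1) m ↑X).Finite ∧ (Dm (d + 1) m ↑X).ncard ≤ m ^ (d + 1) ∧
      ((∃ (v : E (d + 1)) (c : ℝ), v ≠ 0 ∧ ∀ z ∈ Dm (d + 1) m ↑X, ⟪v, z⟫ = c) →
        ∀ hfin : (Dm (d + 1) m ↑X).Finite,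
          IsStiff (d + 1) 1 hfin.toFinset ∧
            ¬ IsSphericalDesign (d + 1) 2 hfin.toFinset ∧
            ¬ IsStiff (d + 1) m hfin.toFinset) := by
  obtain ⟨hF, hC⟩ := Dm_bound hd hm hstiff
  refine ⟨hF, hC, ?_⟩
  rintro ⟨v, c, hv, hvc⟩ hfin
  obtain ⟨z₀, hz₀⟩ := hstiff.2
  have hc : c = 0 := by
    have h1 := hvc z₀ hz₀
    have h2 := hvc _ (Dm_neg hz₀)
    rw [inner_neg_right] at h2
    linarith
  subst hc
  have hnot : ∀ k, 2 ≤ k → ¬ IsSphericalDesign (d + 1) k hfin.toFinset := fun k hk h =>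
    hv (design_two hk h v fun x hx => hvc x (hfin.mem_toFinset.1 hx))
  refine ⟨⟨?_, ?_⟩, hnot 2 le_rfl, fun h => hnot _ (by omega) h.1⟩
  · refine sym_design ?_ ⟨z₀, hfin.mem_toFinset.2 hz₀⟩ ?_
    · intro z hz
      exact (hfin.mem_toFinset.1 hz).1
    · intro z hz
      exact hfin.mem_toFinset.2 (Dm_neg (hfin.mem_toFinset.1 hz))
  · refine ⟨(‖v‖)⁻¹ • v, by simp [norm_smul, hv], {0}, by simp, ?_⟩
    intro z hz
    rw [real_inner_smul_left, hvc z (hfin.mem_toFinset.1 hz)]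
    simp
end
end
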